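/- Under the hypotheses of the construction (d ≥ 2, n > 3d sufficiently large, char(k) ≠ 2, f as in Construction 5 of the paper), the degree −d part of the Macaulay inverse system of I = (f)_{S_n} is the span of the monomial symmetric polynomials: (I^⊥)_{-d} = ⟨ m_λ : λ ⊢ d, λ ≠ (d) ⟩, where m_λ = Σ y_{i_1}^{(λ_1)}···y_{i_s}^{(λ_s)} is the sum over all distinct monomials in S of type λ. In particular S_n acts trivially on (I^⊥)_{-d}. -/

import Mathlib

open MvPolynomial

noncomputable section
namespace PSI

open scoped Classical

variable (k : Type) [Field k] (n : ℕ)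

/-- The contraction action of `R = k[x_1,…,x_n]` on its graded dual `S`, where `S` is
modeled by polynomials in the dual variables `y_i` (dual basis to the monomial basis);
on basis elements, `x^d ∘ y^(e) = y^(e-d)` if `d ≤ e` componentwise and `0` otherwise. -/
def contract (f g : MvPolynomial (Fin n) k) : MvPolynomial (Fin n) k :=
  ∑ d ∈ f.support, f.coeff d • g.divMonomial d

theorem divMonomial_add (a b : MvPolynomial (Fin n) k) (s : Fin n →₀ ℕ) :
    (a + b).divMonomial s = a.divMonomial s + b.divMonomial s := by
  ext c; simp [MvPolynomial.coeff_divMonomial]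

theorem divMonomial_smul (r : k) (a : MvPolynomial (Fin n) k) (s : Fin n →₀ ℕ) :
    (r • a).divMonomial s = r • a.divMonomial s := by
  ext c; simp [MvPolynomial.coeff_divMonomial]

theorem divMonomial_zero (s : Fin n →₀ ℕ) :
    (0 : MvPolynomial (Fin n) k).divMonomial s = 0 := by
  ext c; simp [MvPolynomial.coeff_divMonomial]

theorem contract_add_right (f a b : MvPolynomial (Fin n) k) :
    contract k n f (a + b) = contract k n f a + contract k n f b := by
  simp [contract, divMonomial_add, smul_add, Finset.sum_add_distrib]

theorem contract_smul_right (f : MvPolynomial (Fin n) k) (r : k) (a : MvPolynomial (Fin n) k) :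
    contract k n f (r • a) = r • contract k n f a := by
  simp only [contract, divMonomial_smul]
  rw [Finset.smul_sum]
  exact Finset.sum_congr rfl fun d _ => smul_comm _ _ _

theorem contract_zero_right (f : MvPolynomial (Fin n) k) : contract k n f 0 = 0 := by
  simp [contract, divMonomial_zero]

/-- The degree `-d` graded piece of the Macaulay inverse system `I^⊥ ⊆ S`:
homogeneous dual polynomials of degree `d` annihilated by `I` under contraction. -/
def perpSub (I : Ideal (MvPolynomial (Fin n) k)) (d : ℕ) :
    Submodule k (MvPolynomial (Fin n) k) where
  carrier := {g | g ∈ homogeneousSubmodule (Fin n) k d ∧ ∀ f ∈ I, contract k n f g = 0}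
  add_mem' := by
    rintro a b ⟨ha1, ha2⟩ ⟨hb1, hb2⟩
    exact ⟨Submodule.add_mem _ ha1 hb1, fun f hf => by
      rw [contract_add_right, ha2 f hf, hb2 f hf, add_zero]⟩
  zero_mem' := ⟨Submodule.zero_mem _, fun f _ => contract_zero_right k n f⟩
  smul_mem' := by
    rintro c a ⟨ha1, ha2⟩
    exact ⟨Submodule.smul_mem _ c ha1, fun f hf => by
      rw [contract_smul_right, ha2 f hf, smul_zero]⟩

/-- The full Macaulay inverse system `I^⊥` as a subset of `S`. -/
def perpSet (I : Ideal (MvPolynomial (Fin n) k)) : Set (MvPolynomial (Fin n) k) :=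
  {g | ∀ f ∈ I, contract k n f g = 0}



/-- The degree `m` graded piece of `A = R/I`, as a `k`-subspace of the quotient. -/
def Agr (I : Ideal (MvPolynomial (Fin n) k)) (m : ℕ) :
    Submodule k (MvPolynomial (Fin n) k ⧸ I) :=
  (homogeneousSubmodule (Fin n) k m).map (Ideal.Quotient.mkₐ k I).toLinearMap

/-- The socle of `A = R/I`: elements annihilated by all the variables. -/
def socSub (I : Ideal (MvPolynomial (Fin n) k)) :
    Submodule k (MvPolynomial (Fin n) k ⧸ I) :=
  ⨅ j : Fin n, LinearMap.ker (LinearMap.mulLeft k (Ideal.Quotient.mk I (X j)))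

/-- `dim_k Soc(A)_j`. -/
def socdim (I : Ideal (MvPolynomial (Fin n) k)) (j : ℕ) : ℕ :=
  Module.finrank k ↥(Agr k n I j ⊓ socSub k n I)

/-- Hilbert function of `A = R/I`. -/
def hfA (I : Ideal (MvPolynomial (Fin n) k)) (i : ℕ) : ℕ :=
  Module.finrank k ↥(Agr k n I i)

/-- `dim_k R_i`. -/
def rdim (i : ℕ) : ℕ := Module.finrank k ↥(homogeneousSubmodule (Fin n) k i)

/-- The degree `i` graded piece of a homogeneous ideal `I`. -/
def Igrade (I : Ideal (MvPolynomial (Fin n) k)) (i : ℕ) :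
    Submodule k (MvPolynomial (Fin n) k) :=
  homogeneousSubmodule (Fin n) k i ⊓ Submodule.restrictScalars k I

/-- The initial degree `t(I)` of a homogeneous ideal. -/
def tdeg (I : Ideal (MvPolynomial (Fin n) k)) : ℕ := sInf {i | Igrade k n I i ≠ ⊥}

/-- The top socle degree `s(A)` of `A = R/I`. -/
def sdeg (I : Ideal (MvPolynomial (Fin n) k)) : ℕ :=
  sSup {i | Agr k n I i ⊓ socSub k n I ≠ ⊥}

/-- `I` is a homogeneous ideal. -/
def IsHomog (I : Ideal (MvPolynomial (Fin n) k)) : Prop :=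
  ∀ f ∈ I, ∀ m : ℕ, homogeneousComponent m f ∈ I

/-- `A = R/I` is a narrow algebra: an artinian graded quotient with `t(I) ≥ s(A)`. -/
def IsNarrow (I : Ideal (MvPolynomial (Fin n) k)) : Prop :=
  IsHomog k n I ∧ IsArtinianRing (MvPolynomial (Fin n) k ⧸ I) ∧ sdeg k n I ≤ tdeg k n I

/-- The homogeneous maximal ideal `m = (x_1,…,x_n)`. -/
def mIdeal : Ideal (MvPolynomial (Fin n) k) := Ideal.span (Set.range X)

/-- The principal symmetric ideal `(f)_{S_n}` generated by the orbit of `f` under the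
symmetric group permuting the variables. -/
def psi (f : MvPolynomial (Fin n) k) : Ideal (MvPolynomial (Fin n) k) :=
  Ideal.span {g | ∃ σ : Equiv.Perm (Fin n), g = rename σ f}

/-- Index type for the coordinates on the parameter space of degree-`d` forms:
exponent vectors of total degree `d`. -/
def DegMon (d : ℕ) : Type := {m : Fin n →₀ ℕ // (m.sum fun _ e => e) = d}

/-- "A general principal symmetric ideal generated in degree `d` satisfies `P`":
there is a nonzero polynomial `h` in the coefficients (i.e. a nonempty Zariski-open
subset of the parameter space `P^{N-1}`) such that `(f)_{S_n}` satisfies `P` whenever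
the coefficient vector of the degree-`d` form `f` does not lie on the hypersurface `h = 0`. -/
def GeneralPSI (d : ℕ) (P : Ideal (MvPolynomial (Fin n) k) → Prop) : Prop :=
  ∃ h : MvPolynomial (DegMon n d) k, h ≠ 0 ∧
    ∀ f ∈ homogeneousSubmodule (Fin n) k d,
      eval (fun m => coeff m.1 f) h ≠ 0 → P (psi k n f)

/-- `P(d)`, the number of partitions of `d`. -/
def Pnum (d : ℕ) : ℕ := Fintype.card (Nat.Partition d)

/-- total degree (weight) of an exponent vector. -/
def wt (m : Fin n →₀ ℕ) : ℕ := m.sum fun _ e => e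

/-- The type of a monomial: the multiset of its nonzero exponents (a partition of its degree). -/
def typeOf (m : Fin n →₀ ℕ) : Multiset ℕ := m.support.val.map m

/-- The finite set of exponent vectors of total degree `d`. -/
def expFinset (d : ℕ) : Finset (Fin n →₀ ℕ) :=
  ((Finset.univ : Finset (Fin n → Fin (d + 1))).image
    (fun v => Finsupp.equivFunOnFinite.symm fun i => (v i : ℕ))).filter
      (fun e => wt n e = d)

/-- The monomial symmetric polynomial `m_λ` (of degree `d = λ.sum`): the sum of all
monomials of type `λ`. -/
def msym (d : ℕ) (lam : Multiset ℕ) : MvPolynomial (Fin n) k :=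
  ∑ e ∈ (expFinset n d).filter (fun e => typeOf n e = lam), monomial e 1

/-- The index set for the binomials `b(λ,γ)` of Construction `c:f`: pairs `(λ, γ)` where
`λ ⊢ d` is a partition of `d` with `λ ≠ (d)` (a multiset of positive parts summing to `d`)
and `γ ⊊ λ` is a proper subpartition. -/
def PairSet (d : ℕ) : Set (Multiset ℕ × Multiset ℕ) :=
  {p | p.1.sum = d ∧ (∀ x ∈ p.1, 0 < x) ∧ p.1 ≠ {d} ∧ p.2 < p.1}

theorem contract_eq_sum_of_subset (f g : MvPolynomial (Fin n) k) {T : Finset (Fin n →₀ ℕ)}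
    (hT : f.support ⊆ T) : contract k n f g = ∑ e ∈ T, f.coeff e • g.divMonomial e :=
  Finset.sum_subset hT fun e _ he => by rw [notMem_support_iff.1 he, zero_smul]

theorem contract_add_left (f f' g : MvPolynomial (Fin n) k) :
    contract k n (f + f') g = contract k n f g + contract k n f' g := by
  rw [contract_eq_sum_of_subset k n (f + f') g support_add,
    contract_eq_sum_of_subset k n f g Finset.subset_union_left,
    contract_eq_sum_of_subset k n f' g Finset.subset_union_right, ← Finset.sum_add_distrib]
  exact Finset.sum_congr rfl fun e _ => by rw [coeff_add, add_smul]

theorem contract_monomial (e : Fin n →₀ ℕ) (r : k) (g : MvPolynomial (Fin n) k) :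
    contract k n (monomial e r) g = r • g.divMonomial e := by
  rw [contract_eq_sum_of_subset k n _ g support_monomial_subset]
  simp

/-- Contraction against a fixed `g`, as an additive map. -/
def contractHom (g : MvPolynomial (Fin n) k) :
    MvPolynomial (Fin n) k →+ MvPolynomial (Fin n) k :=
  AddMonoidHom.mk' (fun f => contract k n f g) fun f f' => contract_add_left k n f f' g

theorem contractHom_apply (f g : MvPolynomial (Fin n) k) :
    contractHom k n g f = contract k n f g := rfl

theorem contract_mul (a f g : MvPolynomial (Fin n) k) :
    contract k n (a * f) g = contract k n a (contract k n f g) := by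
  induction a using MvPolynomial.induction_on' with
  | add p q hp hq => rw [add_mul, contract_add_left, hp, hq, contract_add_left]
  | monomial s r =>
    induction f using MvPolynomial.induction_on' with
    | add p q hp hq => rw [mul_add, contract_add_left, hp, hq, contract_add_left,
        contract_add_right]
    | monomial t q =>
      rw [monomial_mul, contract_monomial, contract_monomial, contract_monomial,
        divMonomial_smul, add_comm s t, MvPolynomial.divMonomial_add, smul_smul]

theorem wt_eq_sum_univ (e : Fin n →₀ ℕ) : wt n e = ∑ i, e i :=
  Finsupp.sum_fintype _ _ fun _ => rfl

theorem wt_eq_sum_typeOf (e : Fin n →₀ ℕ) : wt n e = (typeOf n e).sum := rfl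

theorem wt_add (a b : Fin n →₀ ℕ) : wt n (a + b) = wt n a + wt n b := by
  simp [wt_eq_sum_univ, Finset.sum_add_distrib]

theorem wt_eq_zero {e : Fin n →₀ ℕ} (h : wt n e = 0) : e = 0 := by
  rw [wt_eq_sum_univ, Finset.sum_eq_zero_iff] at h
  ext i
  simpa using h i

theorem mem_homogeneousSubmodule_iff_wt (d : ℕ) (g : MvPolynomial (Fin n) k) :
    g ∈ homogeneousSubmodule (Fin n) k d ↔ ∀ e, wt n e ≠ d → coeff e g = 0 := by
  have hw (e : Fin n →₀ ℕ) : Finsupp.weight (1 : Fin n → ℕ) e = wt n e := by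
    simp [Finsupp.weight_apply, wt]
  rw [mem_homogeneousSubmodule]
  refine ⟨fun h e he => ?_, fun h e he => ?_⟩
  · by_contra hc
    exact he (hw e ▸ h hc)
  · rw [hw e]
    by_contra hc
    exact he (h e hc)

theorem mem_expFinset {d : ℕ} {e : Fin n →₀ ℕ} : e ∈ expFinset n d ↔ wt n e = d := by
  rw [expFinset, Finset.mem_filter, and_iff_right_iff_imp]
  intro h
  have hle (i : Fin n) : e i < d + 1 := by
    rw [← h, wt_eq_sum_univ, Nat.lt_succ_iff]
    exact Finset.single_le_sum (f := fun i => e i) (fun _ _ => Nat.zero_le _) (Finset.mem_univ i)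
  exact Finset.mem_image.2 ⟨fun i => ⟨e i, hle i⟩, Finset.mem_univ _, by ext; simp⟩

theorem coeff_msym (d : ℕ) (lam : Multiset ℕ) (e : Fin n →₀ ℕ) :
    coeff e (msym k n d lam) = if wt n e = d ∧ typeOf n e = lam then 1 else 0 := by
  simp [msym, coeff_sum, coeff_monomial, mem_expFinset]

theorem divMonomial_of_wt_eq {d : ℕ} {g : MvPolynomial (Fin n) k}
    (hg : g ∈ homogeneousSubmodule (Fin n) k d) {e : Fin n →₀ ℕ} (he : wt n e = d) :
    g.divMonomial e = C (coeff e g) := by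
  ext c
  rw [coeff_divMonomial, coeff_C]
  split_ifs with hc
  · rw [← hc, add_zero]
  · refine (mem_homogeneousSubmodule_iff_wt k n d g).1 hg _ fun h => hc ?_
    rw [wt_add, he, Nat.add_eq_left] at h
    exact (wt_eq_zero n h).symm

theorem pos_of_mem_typeOf {e : Fin n →₀ ℕ} {a : ℕ} (ha : a ∈ typeOf n e) : 0 < a := by
  obtain ⟨i, hi, rfl⟩ := Multiset.mem_map.1 ha
  exact Nat.pos_of_ne_zero (Finsupp.mem_support_iff.1 hi)

theorem typeOf_eq_zero {e : Fin n →₀ ℕ} : typeOf n e = 0 ↔ e = 0 := by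
  simp [typeOf]

theorem card_typeOf (e : Fin n →₀ ℕ) : (typeOf n e).card = e.support.card := by
  simp [typeOf]

theorem card_support_le_wt (e : Fin n →₀ ℕ) : e.support.card ≤ wt n e := by
  rw [Finset.card_eq_sum_ones]
  exact Finset.sum_le_sum fun i hi => Nat.one_le_iff_ne_zero.2 (Finsupp.mem_support_iff.1 hi)

theorem typeOf_single (i : Fin n) {d : ℕ} (hd : d ≠ 0) :
    typeOf n (Finsupp.single i d) = {d} := by
  simp [typeOf, Finsupp.support_single, hd]

theorem exists_eq_single_of_typeOf_eq {e : Fin n →₀ ℕ} {d : ℕ} (h : typeOf n e = {d}) :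
    ∃ i, e = Finsupp.single i d := by
  have hc : e.support.card = 1 := by rw [← card_typeOf, h, Multiset.card_singleton]
  obtain ⟨i, hi⟩ := Finset.card_eq_one.1 hc
  refine ⟨i, ?_⟩
  have hv : e i = d := by simpa [typeOf, hi] using h
  rw [Finsupp.support_eq_singleton.1 hi |>.2, hv]

theorem mapDomain_perm_apply (σ : Equiv.Perm (Fin n)) (e : Fin n →₀ ℕ) (i : Fin n) :
    e.mapDomain σ i = e (σ.symm i) :=
  Finsupp.mapDomain_equiv_apply e i

theorem typeOf_mapDomain (σ : Equiv.Perm (Fin n)) (e : Fin n →₀ ℕ) :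
    typeOf n (e.mapDomain σ) = typeOf n e := by
  have hs : (e.mapDomain σ).support = e.support.map σ.toEmbedding := by
    ext i
    simp [Finset.mem_map_equiv]
  simp only [typeOf, hs, Finset.map_val, Multiset.map_map]
  exact Multiset.map_congr rfl fun i _ => by simp

theorem wt_mapDomain (σ : Equiv.Perm (Fin n)) (e : Fin n →₀ ℕ) :
    wt n (e.mapDomain σ) = wt n e := by
  rw [wt_eq_sum_typeOf, typeOf_mapDomain, ← wt_eq_sum_typeOf]

theorem exists_perm_comp_eq {α β : Type*} [Fintype α] (F G : α → β)
    (h : (Finset.univ : Finset α).val.map F = (Finset.univ : Finset α).val.map G) :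
    ∃ σ : Equiv.Perm α, ∀ i, G (σ i) = F i := by
  have hcard (c : β) : Fintype.card {i // F i = c} = Fintype.card {i // G i = c} := by
    have hc := congrArg (Multiset.count c) h
    rw [Multiset.count_map, Multiset.count_map] at hc
    rw [Fintype.card_subtype, Fintype.card_subtype]
    simpa only [Finset.card_def, Finset.filter_val, eq_comm] using hc
  exact ⟨Equiv.ofFiberEquiv fun c => Fintype.equivOfCardEq (hcard c),
    Equiv.ofFiberEquiv_map _⟩

theorem map_univ_val (e : Fin n →₀ ℕ) :
    (Finset.univ : Finset (Fin n)).val.map e =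
      typeOf n e + Multiset.replicate (n - (typeOf n e).card) 0 := by
  have hu : (Finset.univ : Finset (Fin n)).val = e.support.val + (e.supportᶜ).val := by
    rw [← Finset.disjUnion_val _ _ disjoint_compl_right, Finset.disjUnion_eq_union,
      Finset.union_compl]
  rw [hu, Multiset.map_add, typeOf, add_right_inj, Multiset.eq_replicate]
  refine ⟨by simp [Finset.card_compl], fun b hb => ?_⟩
  obtain ⟨i, hi, rfl⟩ := Multiset.mem_map.1 hb
  simpa using hi

theorem map_univ_val_prod {u v : Fin n →₀ ℕ} (h : Disjoint u.support v.support) :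
    (Finset.univ : Finset (Fin n)).val.map (fun i => (u i, v i)) =
      (typeOf n u).map (fun a => (a, 0)) + (typeOf n v).map (fun b => (0, b)) +
        Multiset.replicate (n - ((typeOf n u).card + (typeOf n v).card)) (0, 0) := by
  have hu : (Finset.univ : Finset (Fin n)).val =
      u.support.val + v.support.val + ((u.support ∪ v.support)ᶜ).val := by
    rw [← Finset.disjUnion_val _ _ h, Finset.disjUnion_eq_union,
      ← Finset.disjUnion_val _ _ disjoint_compl_right, Finset.disjUnion_eq_union,
      Finset.union_compl]
  rw [hu, Multiset.map_add, Multiset.map_add, typeOf, typeOf, Multiset.map_map, Multiset.map_map]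
  congr 1
  · congr 1
    · refine Multiset.map_congr rfl fun i hi => ?_
      have := Finset.disjoint_left.1 h hi
      simpa using this
    · refine Multiset.map_congr rfl fun i hi => ?_
      have := Finset.disjoint_right.1 h hi
      simpa using this
  · rw [Multiset.eq_replicate]
    refine ⟨?_, fun b hb => ?_⟩
    · rw [Multiset.card_map, Finset.card_val, Finset.card_compl, Finset.card_union_of_disjoint h,
        Fintype.card_fin, Multiset.card_map, Multiset.card_map, Finset.card_val, Finset.card_val]
    obtain ⟨i, hi, rfl⟩ := Multiset.mem_map.1 hb
    simpa using hi

/-- The symmetric group acts transitively on pairs of coprime monomials of given types. -/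
theorem exists_perm_mapDomain_eq {u v e e' : Fin n →₀ ℕ}
    (huv : Disjoint u.support v.support) (hee : Disjoint e.support e'.support)
    (hu : typeOf n u = typeOf n e) (hv : typeOf n v = typeOf n e') :
    ∃ σ : Equiv.Perm (Fin n), u.mapDomain σ = e ∧ v.mapDomain σ = e' := by
  obtain ⟨σ, hσ⟩ := exists_perm_comp_eq (fun i => (u i, v i)) (fun i => (e i, e' i))
    (by rw [map_univ_val_prod n huv, map_univ_val_prod n hee, hu, hv])
  refine ⟨σ, ?_, ?_⟩ <;> ext i <;> rw [mapDomain_perm_apply]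
  · simpa using (congrArg Prod.fst (hσ (σ.symm i))).symm
  · simpa using (congrArg Prod.snd (hσ (σ.symm i))).symm

/-- The two terms of an admissible binomial are exchanged by a permutation fixing every variable
in which they have the same exponent. -/
theorem exists_perm_swap {u v : Fin n →₀ ℕ} (ht : typeOf n u = typeOf n v)
    (h : ∀ i, u i = v i ∨ min (u i) (v i) = 0) :
    ∃ τ : Equiv.Perm (Fin n), u.mapDomain τ = v ∧ v.mapDomain τ = u ∧
      ∀ i, u i = v i → τ i = i := by
  set U := (Finset.univ : Finset (Fin n)).val
  set E := U.filter fun i => u i = v i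
  set D := U.filter fun i => ¬ u i = v i
  set A := D.filter fun i => v i = 0
  set B := D.filter fun i => ¬ v i = 0
  have hE : ∀ i ∈ E, u i = v i := fun i hi => (Multiset.mem_filter.1 hi).2
  have hD : ∀ i ∈ D, u i ≠ v i := fun i hi => (Multiset.mem_filter.1 hi).2
  have hA : ∀ i ∈ A, u i ≠ 0 ∧ v i = 0 := fun i hi => by
    have h1 := hD i (Multiset.mem_filter.1 hi).1
    have h2 := (Multiset.mem_filter.1 hi).2
    omega
  have hB : ∀ i ∈ B, u i = 0 ∧ v i ≠ 0 := fun i hi => by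
    have h1 := hD i (Multiset.mem_filter.1 hi).1
    have h2 := (Multiset.mem_filter.1 hi).2
    have := h i
    omega
  have hU : U = E + (A + B) := by
    rw [Multiset.filter_add_not, Multiset.filter_add_not]
  have hAB : A.map u = B.map v := by
    have h1 : U.map u = U.map v := by rw [map_univ_val, map_univ_val, ht]
    simp only [hU, Multiset.map_add] at h1
    rw [Multiset.map_congr rfl hE, add_right_inj] at h1
    have h2 := congrArg (Multiset.filter (· ≠ 0)) h1
    rw [Multiset.filter_add, Multiset.filter_add] at h2
    rw [Multiset.filter_eq_self.2, Multiset.filter_eq_nil.2, Multiset.filter_eq_nil.2,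
      Multiset.filter_eq_self.2, add_zero, zero_add] at h2
    · exact h2
    all_goals
      intro a ha
      obtain ⟨i, hi, rfl⟩ := Multiset.mem_map.1 ha
      first
        | have := hA i hi
          omega
        | have := hB i hi
          omega
  let t : Fin n → Option (Fin n) := fun i => if u i = v i then some i else none
  have hmap : U.map (fun i => (u i, v i, t i)) = U.map (fun i => (v i, u i, t i)) := by
    have hE' : E.map (fun i => (u i, v i, t i)) = E.map (fun i => (v i, u i, t i)) :=
      Multiset.map_congr rfl fun i hi => by rw [hE i hi]
    have hA₁ : A.map (fun i => (u i, v i, t i)) = (A.map u).map (fun a => (a, 0, none)) := by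
      rw [Multiset.map_map]
      exact Multiset.map_congr rfl fun i hi => by simp [t, hA i hi]
    have hA₂ : A.map (fun i => (v i, u i, t i)) = (A.map u).map (fun a => (0, a, none)) := by
      rw [Multiset.map_map]
      exact Multiset.map_congr rfl fun i hi => by simp [t, hA i hi]
    have hB₁ : B.map (fun i => (u i, v i, t i)) = (B.map v).map (fun a => (0, a, none)) := by
      rw [Multiset.map_map]
      exact Multiset.map_congr rfl fun i hi => by simp [t, hB i hi, (hB i hi).2.symm]
    have hB₂ : B.map (fun i => (v i, u i, t i)) = (B.map v).map (fun a => (a, 0, none)) := by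
      rw [Multiset.map_map]
      exact Multiset.map_congr rfl fun i hi => by simp [t, hB i hi, (hB i hi).2.symm]
    simp only [hU, Multiset.map_add]
    rw [hE', hA₁, hA₂, hB₁, hB₂, hAB, add_comm (Multiset.map (fun a => (a, 0, none)) _)]
  obtain ⟨τ, hτ⟩ := exists_perm_comp_eq _ _ hmap
  refine ⟨τ, ?_, ?_, fun i hi => ?_⟩
  · ext i
    rw [mapDomain_perm_apply]
    simpa using (congrArg Prod.fst (hτ (τ.symm i))).symm
  · ext i
    rw [mapDomain_perm_apply]
    simpa using (congrArg (fun x => x.2.1) (hτ (τ.symm i))).symm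
  · have h3 := congrArg (fun x => x.2.2) (hτ i)
    simp only [t, if_pos hi] at h3
    split_ifs at h3
    exact Option.some_injective _ h3

theorem exists_typeOf_eq_disjoint_support (e : Fin n →₀ ℕ) (T : Finset (Fin n))
    (h : T.card + e.support.card ≤ n) :
    ∃ e' : Fin n →₀ ℕ, typeOf n e' = typeOf n e ∧ Disjoint T e'.support := by
  obtain ⟨s, hs, hsc⟩ := Finset.exists_subset_card_eq (s := Tᶜ) (n := e.support.card)
    (by rw [Finset.card_compl, Fintype.card_fin]; omega)
  let σ : Equiv.Perm (Fin n) := (Finset.equivOfCardEq hsc).symm.extendSubtype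
  refine ⟨e.mapDomain σ, typeOf_mapDomain n σ e, Finset.disjoint_right.2 fun i hi => ?_⟩
  rw [Finsupp.mem_support_iff, mapDomain_perm_apply, ← Finsupp.mem_support_iff] at hi
  have := (Finset.equivOfCardEq hsc).symm.extendSubtype_mem (σ.symm i) hi
  rw [show Equiv.extendSubtype _ = σ from rfl, Equiv.apply_symm_apply] at this
  exact Finset.mem_compl.1 (hs this)

theorem mapDomain_eq_self {τ : Equiv.Perm (Fin n)} {e : Fin n →₀ ℕ}
    (h : ∀ i ∈ e.support, τ i = i) : e.mapDomain τ = e := by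
  rw [Finsupp.mapDomain_congr (g := id) h, Finsupp.mapDomain_id]

theorem mem_span_msym_iff (d : ℕ) (g : MvPolynomial (Fin n) k) (hd : d ≠ 0) :
    g ∈ Submodule.span k
        {g | ∃ lam : Nat.Partition d, lam.parts ≠ {d} ∧ g = msym k n d lam.parts} ↔
      g ∈ homogeneousSubmodule (Fin n) k d ∧ (∀ i, coeff (Finsupp.single i d) g = 0) ∧
        ∀ e e', wt n e = d → typeOf n e = typeOf n e' → coeff e g = coeff e' g := by
  constructor
  · intro hg
    induction hg using Submodule.span_induction with
    | zero => exact ⟨Submodule.zero_mem _, by simp, by simp⟩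
    | add a b _ _ ha hb =>
      refine ⟨Submodule.add_mem _ ha.1 hb.1, fun i => ?_, fun e e' he ht => ?_⟩
      · rw [coeff_add, ha.2.1, hb.2.1, add_zero]
      · rw [coeff_add, coeff_add, ha.2.2 e e' he ht, hb.2.2 e e' he ht]
    | smul c a _ ha =>
      refine ⟨Submodule.smul_mem _ _ ha.1, fun i => ?_, fun e e' he ht => ?_⟩
      · rw [coeff_smul, ha.2.1, smul_zero]
      · rw [coeff_smul, coeff_smul, ha.2.2 e e' he ht]
    | mem g hg =>
      obtain ⟨lam, hlam, rfl⟩ := hg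
      refine ⟨(mem_homogeneousSubmodule_iff_wt k n d _).2 fun e he => ?_, fun i => ?_,
        fun e e' he ht => ?_⟩
      · rw [coeff_msym, if_neg fun h => he h.1]
      · rw [coeff_msym, if_neg fun h => hlam (h.2.symm.trans (typeOf_single n i hd))]
      · rw [coeff_msym, coeff_msym, wt_eq_sum_typeOf, wt_eq_sum_typeOf, ht]
  · rintro ⟨hhom, hsingle, htype⟩
    let c : Nat.Partition d → k := fun lam =>
      if h : ∃ e, typeOf n e = lam.parts then coeff h.choose g else 0
    have hg : g = ∑ lam : Nat.Partition d with lam.parts ≠ {d},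
        c lam • msym k n d lam.parts := by
      ext e
      simp only [coeff_sum, coeff_smul, coeff_msym]
      by_cases he : wt n e = d
      · let lam : Nat.Partition d := ⟨typeOf n e, fun h => pos_of_mem_typeOf n h, he⟩
        have hlam : typeOf n e = lam.parts := rfl
        by_cases hs : typeOf n e = {d}
        · obtain ⟨i, rfl⟩ := exists_eq_single_of_typeOf_eq n hs
          rw [hsingle, Finset.sum_eq_zero]
          intro mu hmu
          rw [if_neg fun h => (Finset.mem_filter.1 hmu).2 (h.2.symm.trans hs), smul_zero]
        · rw [Finset.sum_eq_single_of_mem lam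
            (Finset.mem_filter.2 ⟨Finset.mem_univ _, hs⟩), if_pos ⟨he, hlam⟩]
          · have hex : ∃ e, typeOf n e = lam.parts := ⟨e, hlam⟩
            simp only [c, dif_pos hex, smul_eq_mul, mul_one]
            exact htype _ _ he (hlam.trans hex.choose_spec.symm)
          · intro mu _ hmu
            rw [if_neg fun h => hmu (Nat.Partition.ext (h.2.symm.trans hlam)), smul_zero]
      · rw [(mem_homogeneousSubmodule_iff_wt k n d g).1 hhom e he, Finset.sum_eq_zero]
        intro mu _
        rw [if_neg fun h => he h.1, smul_zero]
    rw [hg]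
    exact Submodule.sum_mem _ fun lam hlam => Submodule.smul_mem _ _ <|
      Submodule.subset_span ⟨lam, (Finset.mem_filter.1 hlam).2, rfl⟩

theorem mem_perpSub_psi_iff (d : ℕ) (f g : MvPolynomial (Fin n) k) :
    g ∈ perpSub k n (psi k n f) d ↔ g ∈ homogeneousSubmodule (Fin n) k d ∧
      ∀ σ : Equiv.Perm (Fin n), contract k n (rename σ f) g = 0 := by
  refine and_congr_right fun _ => ⟨fun h σ => h _ (Ideal.subset_span ⟨σ, rfl⟩), fun h x hx => ?_⟩
  induction hx using Submodule.span_induction with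
  | mem x hx =>
    obtain ⟨σ, rfl⟩ := hx
    exact h σ
  | zero => simp [contract]
  | add x y _ _ hx hy => rw [contract_add_left, hx, hy, add_zero]
  | smul a x _ hx => rw [smul_eq_mul, contract_mul, hx, contract_zero_right]

theorem contract_rename_binomials {ι : Type*} (s : Finset ι) (d : ℕ) (u v : ι → Fin n →₀ ℕ)
    (w : Fin n →₀ ℕ) (hu : ∀ p ∈ s, wt n (u p) = d) (hv : ∀ p ∈ s, wt n (v p) = d)
    (hw : wt n w = d) {g : MvPolynomial (Fin n) k}
    (hg : g ∈ homogeneousSubmodule (Fin n) k d) (σ : Equiv.Perm (Fin n)) :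
    contract k n (rename σ (monomial w 1 +
        ∑ p ∈ s, (monomial (u p) 1 - monomial (v p) (1 : k)))) g =
      C (coeff (w.mapDomain σ) g +
        ∑ p ∈ s, (coeff ((u p).mapDomain σ) g - coeff ((v p).mapDomain σ) g)) := by
  have hmon {e : Fin n →₀ ℕ} (he : wt n e = d) :
      contractHom k n g (rename σ (monomial e 1)) = C (coeff (e.mapDomain σ) g) := by
    rw [rename_monomial, contractHom_apply, contract_monomial, one_smul,
      divMonomial_of_wt_eq k n hg ((wt_mapDomain n σ e).trans he)]
  rw [← contractHom_apply, map_add, map_add, map_add, map_sum, map_sum, map_sum, hmon hw]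
  congr 1
  refine Finset.sum_congr rfl fun p hp => ?_
  rw [map_sub, map_sub, map_sub, hmon (hu p hp), hmon (hv p hp)]

/-- Proposition `lem:generalexample`(3): with `f` as in Construction `c:f`, the degree `−d`
part of the Macaulay inverse system of `I = (f)_{S_n}` is the span of the monomial
symmetric polynomials `m_λ`, `λ ⊢ d`, `λ ≠ (d)`; in particular `S_n` acts trivially
on `(I^⊥)_{-d}`. -/
theorem stmt12 (d : ℕ) (hd : 2 ≤ d) (hn : 3 * d < n) (hchar : ringChar k ≠ 2)
    (u v : Multiset ℕ × Multiset ℕ → (Fin n →₀ ℕ))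
    (hfin : (PairSet d).Finite)
    (htype : ∀ p ∈ PairSet d, typeOf n (u p) = p.1 ∧ typeOf n (v p) = p.1)
    (hne : ∀ p ∈ PairSet d, u p ≠ v p)
    (hadm : ∀ p ∈ PairSet d, ∀ i : Fin n, (u p) i = (v p) i ∨ min ((u p) i) ((v p) i) = 0)
    (hgcd : ∀ p ∈ PairSet d,
      typeOf n (Finsupp.zipWith min (by simp) (u p) (v p)) = p.2)
    (hdisj : ∀ p ∈ PairSet d, ∀ q ∈ PairSet d, p ≠ q →
      Disjoint ((u p).support ∪ (v p).support) ((u q).support ∪ (v q).support))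
    (h0 : ∀ p ∈ PairSet d, (⟨0, by omega⟩ : Fin n) ∉ (u p).support ∪ (v p).support)
    (f : MvPolynomial (Fin n) k)
    (hf : f = monomial (Finsupp.single (⟨0, by omega⟩ : Fin n) d) 1 +
      ∑ p ∈ hfin.toFinset, (monomial (u p) 1 - monomial (v p) 1)) :
    perpSub k n (psi k n f) d = Submodule.span k
        {g | ∃ lam : Nat.Partition d, lam.parts ≠ {d} ∧ g = msym k n d lam.parts} ∧
    ∀ σ : Equiv.Perm (Fin n), ∀ g ∈ perpSub k n (psi k n f) d, rename (⇑σ) g = g := by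
  have hd0 : d ≠ 0 := by omega
  set o : Fin n := ⟨0, by omega⟩
  have hu : ∀ p ∈ hfin.toFinset, wt n (u p) = d := fun p hp => by
    have hp := hfin.mem_toFinset.1 hp
    rw [wt_eq_sum_typeOf, (htype p hp).1, hp.1]
  have hv : ∀ p ∈ hfin.toFinset, wt n (v p) = d := fun p hp => by
    have hp := hfin.mem_toFinset.1 hp
    rw [wt_eq_sum_typeOf, (htype p hp).2, hp.1]
  have ho : wt n (Finsupp.single o d) = d := by simp [wt]
  have hspan : perpSub k n (psi k n f) d = Submodule.span k
      {g | ∃ lam : Nat.Partition d, lam.parts ≠ {d} ∧ g = msym k n d lam.parts} := by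
    ext g
    rw [mem_span_msym_iff k n d g hd0, mem_perpSub_psi_iff]
    refine and_congr_right fun hg => ?_
    simp only [hf, contract_rename_binomials k n hfin.toFinset d u v _ hu hv ho hg, C_eq_zero,
      Finsupp.mapDomain_single]
    constructor
    · intro hF
      have hswap : ∀ p ∈ PairSet d, ∀ σ : Equiv.Perm (Fin n),
          coeff ((u p).mapDomain σ) g = coeff ((v p).mapDomain σ) g := by
        intro p hp σ
        obtain ⟨τ, huτ, hvτ, hτ⟩ := exists_perm_swap n
          ((htype p hp).1.trans (htype p hp).2.symm) (hadm p hp)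
        have hfix (i : Fin n) (hi : i ∉ (u p).support ∪ (v p).support) : τ i = i := by
          have hi' : u p i = 0 ∧ v p i = 0 := by simpa using hi
          exact hτ i (hi'.1.trans hi'.2.symm)
        have hcomp (e : Fin n →₀ ℕ) : e.mapDomain (σ * τ) = (e.mapDomain τ).mapDomain σ := by
          rw [← Finsupp.mapDomain_comp, Equiv.Perm.coe_mul]
        have hother : ∀ q ∈ hfin.toFinset.erase p,
            coeff ((u q).mapDomain (σ * τ)) g - coeff ((v q).mapDomain (σ * τ)) g =
              coeff ((u q).mapDomain σ) g - coeff ((v q).mapDomain σ) g := by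
          intro q hq
          have hq := Finset.mem_erase.1 hq
          have hdis := hdisj q (hfin.mem_toFinset.1 hq.2) p hp hq.1
          rw [hcomp, hcomp, mapDomain_eq_self n fun i hi => hfix i <|
              Finset.disjoint_left.1 hdis (Finset.mem_union_left _ hi),
            mapDomain_eq_self n fun i hi => hfix i <|
              Finset.disjoint_left.1 hdis (Finset.mem_union_right _ hi)]
        have h1 := hF σ
        have h2 := hF (σ * τ)
        have hp' := hfin.mem_toFinset.2 hp
        rw [← Finset.add_sum_erase _ _ hp'] at h1 h2
        rw [Finset.sum_congr rfl hother, hcomp, hcomp, huτ, hvτ, Equiv.Perm.mul_apply,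
          hfix o (h0 p hp)] at h2
        have h3 : (2 : k) * (coeff ((u p).mapDomain σ) g - coeff ((v p).mapDomain σ) g) = 0 := by
          linear_combination h1 - h2
        exact sub_eq_zero.1 ((mul_eq_zero.1 h3).resolve_left (Ring.two_ne_zero hchar))
      have hsingle (i : Fin n) : coeff (Finsupp.single i d) g = 0 := by
        have h1 := hF (Equiv.swap o i)
        rwa [Finset.sum_eq_zero fun p hp => sub_eq_zero.2
          (hswap p (hfin.mem_toFinset.1 hp) _), add_zero, Equiv.swap_apply_left] at h1
      refine ⟨hsingle, fun e e' he ht => ?_⟩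
      by_cases hs : typeOf n e = {d}
      · obtain ⟨i, rfl⟩ := exists_eq_single_of_typeOf_eq n hs
        obtain ⟨j, rfl⟩ := exists_eq_single_of_typeOf_eq n (ht ▸ hs)
        rw [hsingle, hsingle]
      have hp : (typeOf n e, (0 : Multiset ℕ)) ∈ PairSet d := by
        refine ⟨he, fun _ => pos_of_mem_typeOf n, hs, pos_iff_ne_zero.2 fun h => ?_⟩
        exact hd0 (by rw [← he, wt_eq_sum_typeOf, show typeOf n e = 0 from h, Multiset.sum_zero])
      have hcoprime : Disjoint (u (typeOf n e, 0)).support (v (typeOf n e, 0)).support := by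
        have h1 := (typeOf_eq_zero n).1 (hgcd _ hp)
        refine Finset.disjoint_left.2 fun i hi hi' => ?_
        have h2 := DFunLike.congr_fun h1 i
        rw [Finsupp.zipWith_apply, Finsupp.zero_apply] at h2
        rw [Finsupp.mem_support_iff] at hi hi'
        omega
      have hdisjoint {a b : Fin n →₀ ℕ} (ha : typeOf n a = typeOf n e)
          (hb : typeOf n b = typeOf n e) (hab : Disjoint a.support b.support) :
          coeff a g = coeff b g := by
        obtain ⟨σ, rfl, rfl⟩ := exists_perm_mapDomain_eq n hcoprime hab
          ((htype _ hp).1.trans ha.symm) ((htype _ hp).2.trans hb.symm)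
        exact hswap _ hp σ
      have hcard : (e.support ∪ e'.support).card + e.support.card ≤ n := by
        have h1 := Finset.card_union_le e.support e'.support
        have h2 := card_support_le_wt n e
        have h3 : e'.support.card = e.support.card := by rw [← card_typeOf, ← ht, card_typeOf]
        omega
      obtain ⟨a, ha, hdis⟩ := exists_typeOf_eq_disjoint_support n e _ hcard
      rw [Finset.disjoint_union_left] at hdis
      exact (hdisjoint rfl ha hdis.1).trans (hdisjoint ht.symm ha hdis.2).symm
    · rintro ⟨hsingle, hinv⟩ σ
      rw [hsingle, zero_add]
      refine Finset.sum_eq_zero fun p hp => sub_eq_zero.2 (hinv _ _ ?_ ?_)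
      · rw [wt_mapDomain, hu p hp]
      · have hp := htype p (hfin.mem_toFinset.1 hp)
        rw [typeOf_mapDomain, typeOf_mapDomain, hp.1, hp.2]
  refine ⟨hspan, fun σ g hg => ?_⟩
  rw [hspan, mem_span_msym_iff k n d g hd0] at hg
  ext e
  obtain ⟨e, rfl⟩ : ∃ e', e'.mapDomain σ = e :=
    ⟨e.mapDomain σ.symm, by ext i; simp⟩
  rw [coeff_rename_mapDomain _ σ.injective]
  by_cases he : wt n e = d
  · exact hg.2.2 _ _ he (typeOf_mapDomain n σ e).symm
  · have hz := (mem_homogeneousSubmodule_iff_wt k n d g).1 hg.1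
    rw [hz e he, hz _ (by rwa [wt_mapDomain])]

end PSI
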